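/- Empirical quantile integral identity: let a, b : Fin n → ℝ be tuples each sorted in nondecreasing order, and let μ_a = (1/n)∑_{i=1}^n δ_{a_i} and μ_b = (1/n)∑_{i=1}^n δ_{b_i} be their empirical probability measures with quantile functions Q_{μ_a} and Q_{μ_b}. Then ∫_0^1 (Q_{μ_a}(u) − Q_{μ_b}(u))² du = (1/n) ∑_{i=1}^n (a_i − b_i)², i.e. the squared quantile-coupling integral of two equal-size empirical distributions equals the average squared difference of the sorted values. -/

import Mathlib

open MeasureTheory ProbabilityTheory

/-- The quantile function of a probability measure `μ` on `ℝ`: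
`Q_μ(u) = inf {x : ℝ | F_μ(x) ≥ u}` where `F_μ(x) = μ((-∞, x])` is the CDF. -/
noncomputable def quantileFn (μ : Measure ℝ) (u : ℝ) : ℝ :=
  sInf {x : ℝ | u ≤ (μ (Set.Iic x)).toReal}

/-- The empirical probability measure `(1/n) ∑ i, δ_{a i}` of a tuple
`a : Fin n → ℝ`. -/
noncomputable def empiricalMeasure (n : ℕ) (a : Fin n → ℝ) : Measure ℝ :=
  ((n : ENNReal))⁻¹ • ∑ i : Fin n, Measure.dirac (a i)

theorem empiricalMeasure_Iic_toReal (n : ℕ) (a : Fin n → ℝ) (x : ℝ) :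
    (empiricalMeasure n a (Set.Iic x)).toReal
      = ((Finset.univ.filter fun i => a i ≤ x).card : ℝ) / n := by
  have h : ∀ i, Measure.dirac (a i) (Set.Iic x) = if a i ≤ x then (1 : ENNReal) else 0 := by
    intro i
    rw [Measure.dirac_apply' _ measurableSet_Iic]
    simp [Set.indicator_apply]
  simp only [empiricalMeasure, Measure.smul_apply, Measure.finsetSum_apply, h, smul_eq_mul,
    Finset.sum_boole, ENNReal.toReal_mul, ENNReal.toReal_inv, ENNReal.toReal_natCast]
  rw [div_eq_inv_mul]

/-- The quantile function of the empirical measure of a sorted tuple equals `a i` on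
`(i / n, (i + 1) / n]`. -/
theorem quantileFn_empiricalMeasure {n : ℕ} {a : Fin n → ℝ} (ha : Monotone a) (i : Fin n) {u : ℝ}
    (hu : u ∈ Set.Ioc ((i : ℝ) / n) (((i : ℝ) + 1) / n)) :
    quantileFn (empiricalMeasure n a) u = a i := by
  have hn : (0 : ℝ) < n := by exact_mod_cast i.pos
  have hset : {x : ℝ | u ≤ (empiricalMeasure n a (Set.Iic x)).toReal} = Set.Ici (a i) := by
    ext x
    rw [Set.mem_ofPred_eq, Set.mem_Ici, empiricalMeasure_Iic_toReal]
    constructor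
    · intro h
      by_contra! hx
      have hsub : (Finset.univ.filter fun j => a j ≤ x) ⊆ Finset.Iio i := by
        intro j hj
        rw [Finset.mem_filter] at hj
        rw [Finset.mem_Iio]
        by_contra! hij
        exact absurd (ha hij) (not_le.mpr (hj.2.trans_lt hx))
      have hcard := Finset.card_le_card hsub
      rw [Fin.card_Iio] at hcard
      have hcard' : ((Finset.univ.filter fun j => a j ≤ x).card : ℝ) ≤ i := by
        exact_mod_cast hcard
      have := div_le_div_of_nonneg_right hcard' hn.le
      linarith [hu.1]
    · intro h
      have hsub : Finset.Iic i ⊆ Finset.univ.filter fun j => a j ≤ x := by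
        intro j hj
        rw [Finset.mem_Iic] at hj
        exact Finset.mem_filter.mpr ⟨Finset.mem_univ _, (ha hj).trans h⟩
      have hcard := Finset.card_le_card hsub
      rw [Fin.card_Iic] at hcard
      have hcard' : (i : ℝ) + 1 ≤ ((Finset.univ.filter fun j => a j ≤ x).card : ℝ) := by
        exact_mod_cast hcard
      exact hu.2.trans (div_le_div_of_nonneg_right hcard' hn.le)
  rw [quantileFn, hset, csInf_Ici]

/-- **Empirical quantile integral identity.**  For tuples `a, b : Fin n → ℝ`
each sorted in nondecreasing order, with empirical measures `μ_a` and `μ_b`,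
the squared quantile-coupling integral equals the average squared difference
of the sorted values:
`∫_0^1 (Q_{μ_a}(u) - Q_{μ_b}(u))² du = (1/n) ∑ i, (a i - b i)²`. -/
theorem empirical_quantile_integral_identity
    (n : ℕ) (hn : 0 < n) (a b : Fin n → ℝ) (ha : Monotone a) (hb : Monotone b) :
    ∫ u in Set.Ioo (0 : ℝ) 1,
        (quantileFn (empiricalMeasure n a) u - quantileFn (empiricalMeasure n b) u) ^ 2
      = (1 / (n : ℝ)) * ∑ i, (a i - b i) ^ 2 := by
  have hn' : (0 : ℝ) < n := by exact_mod_cast hn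
  set f : ℝ → ℝ := fun u =>
    (quantileFn (empiricalMeasure n a) u - quantileFn (empiricalMeasure n b) u) ^ 2 with hf
  have hle : ∀ k : ℕ, (k : ℝ) / n ≤ ((k + 1 : ℕ) : ℝ) / n := fun k => by
    gcongr
    exact k.le_succ
  have hEq : ∀ i : Fin n, Set.EqOn (fun _ => (a i - b i) ^ 2) f
      (Set.uIoc (((i : ℕ) : ℝ) / n) (((i : ℕ) + 1 : ℕ) / n)) := by
    intro i u hu
    rw [Set.uIoc_of_le (hle i), Nat.cast_add_one] at hu
    simp only [hf, quantileFn_empiricalMeasure ha i hu, quantileFn_empiricalMeasure hb i hu]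
  have hint : ∀ k < n, IntervalIntegrable f volume ((k : ℝ) / n) ((k + 1 : ℕ) / n) :=
    fun k hk => (intervalIntegrable_const (c := (a ⟨k, hk⟩ - b ⟨k, hk⟩) ^ 2)).congr (hEq ⟨k, hk⟩)
  have hsum := intervalIntegral.sum_integral_adjacent_intervals
    (a := fun k : ℕ => (k : ℝ) / n) hint
  rw [Nat.cast_zero, zero_div, div_self hn'.ne'] at hsum
  rw [← integral_Ioc_eq_integral_Ioo, ← intervalIntegral.integral_of_le zero_le_one, ← hsum,
    Finset.sum_range, Finset.mul_sum]
  refine Finset.sum_congr rfl fun i _ => ?_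
  rw [← intervalIntegral.integral_congr_ae (ae_of_all _ fun _ h => hEq i h), intervalIntegral.integral_const,
    smul_eq_mul, Nat.cast_add_one]
  ring
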